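/- Let n > 2; on ℝⁿ with coordinates (t, Y¹, …, Y^{n−1}) and Minkowski metric η = diag(−1,1,…,1), let ξ be a smooth CKV of η with conformal factor ψ satisfying □ψ = 0, let a₀ ∈ ℝ, and let b satisfy □b = 0. Then for every smooth solution u of the wave equation □u = −u_{tt} + Σ_α u_{Y^αY^α} = 0, the function w = ((2−n)/2) ψ u + a₀ u + b − ξ^μ ∂_μ u also solves □w = 0. (This is the evolutionary form of the statement that the Lie point symmetries of the wave equation in n-dimensional Minkowski spacetime are generated by the CKVs of the Minkowski metric whose conformal factor solves the wave equation.) -/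

import Mathlib

/-- Partial derivative `∂f/∂xⁱ` of a function `f : ℝⁿ → ℝ`. -/
noncomputable def pd {n : ℕ} (i : Fin n) (f : (Fin n → ℝ) → ℝ) : (Fin n → ℝ) → ℝ :=
  fun x => fderiv ℝ f x (Pi.single i 1)

/-- The Minkowski metric `η = diag(−1, 1, …, 1)` on ℝ^{m+1}; index `0` is `t`. -/
def eta {m : ℕ} (μ ν : Fin (m + 1)) : ℝ :=
  if μ = ν then (if μ = 0 then -1 else 1) else 0

/-- The wave operator `□f = −∂²_t f + Σ_α ∂²_{Y^α} f` on ℝ^{m+1}. -/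
noncomputable def box {m : ℕ} (f : (Fin (m + 1) → ℝ) → ℝ) : (Fin (m + 1) → ℝ) → ℝ :=
  fun x => ∑ μ, (if μ = 0 then (-1 : ℝ) else 1) * pd μ (pd μ f) x

abbrev Sm {n : ℕ} (f : (Fin n → ℝ) → ℝ) : Prop := ContDiff ℝ (⊤ : ℕ∞) f

def sg {m : ℕ} (μ : Fin (m + 1)) : ℝ := if μ = 0 then -1 else 1

lemma sg_sq {m : ℕ} (μ : Fin (m + 1)) : sg μ * sg μ = 1 := by
  unfold sg; split_ifs <;> norm_num

lemma Sm.da {n : ℕ} {f : (Fin n → ℝ) → ℝ} (hf : Sm f) (x) : DifferentiableAt ℝ f x :=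
  (hf.differentiable (by simp)) x

lemma Sm.pd {n : ℕ} {f : (Fin n → ℝ) → ℝ} (hf : Sm f) (i : Fin n) : Sm (pd i f) := by
  have h : ContDiff ℝ (⊤ : ℕ∞) (fderiv ℝ f) := hf.fderiv_right (by simp)
  exact h.clm_apply contDiff_const

lemma pd_add {n : ℕ} {f g : (Fin n → ℝ) → ℝ} (hf : Sm f) (hg : Sm g) (i : Fin n) :
    pd i (fun y => f y + g y) = fun y => pd i f y + pd i g y := by
  funext x
  simp only [pd]
  rw [fderiv_fun_add (hf.da x) (hg.da x)]; rfl

lemma pd_sub {n : ℕ} {f g : (Fin n → ℝ) → ℝ} (hf : Sm f) (hg : Sm g) (i : Fin n) :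
    pd i (fun y => f y - g y) = fun y => pd i f y - pd i g y := by
  funext x
  simp only [pd]
  rw [fderiv_fun_sub (hf.da x) (hg.da x)]; rfl

lemma pd_mul {n : ℕ} {f g : (Fin n → ℝ) → ℝ} (hf : Sm f) (hg : Sm g) (i : Fin n) :
    pd i (fun y => f y * g y) = fun y => pd i f y * g y + f y * pd i g y := by
  funext x
  simp only [pd]
  rw [fderiv_fun_mul (hf.da x) (hg.da x)]
  simp; ring

lemma pd_cmul {n : ℕ} {f : (Fin n → ℝ) → ℝ} (hf : Sm f) (c : ℝ) (i : Fin n) :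
    pd i (fun y => c * f y) = fun y => c * pd i f y := by
  funext x
  simp only [pd]
  rw [fderiv_const_mul (hf.da x)]; rfl

lemma pd_sum {n : ℕ} {ι : Type} [Fintype ι] {f : ι → (Fin n → ℝ) → ℝ} (hf : ∀ k, Sm (f k))
    (i : Fin n) :
    pd i (fun y => ∑ k, f k y) = fun y => ∑ k, pd i (f k) y := by
  funext x
  simp only [pd]
  rw [fderiv_fun_sum (fun k _ => (hf k).da x)]; simp

lemma pd_comm {n : ℕ} {f : (Fin n → ℝ) → ℝ} (hf : Sm f) (i j : Fin n) :
    pd i (pd j f) = pd j (pd i f) := by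
  funext x
  have h : ContDiff ℝ (⊤ : ℕ∞) (fderiv ℝ f) := hf.fderiv_right (by simp)
  have hd : DifferentiableAt ℝ (fderiv ℝ f) x := (h.differentiable (by simp)) x
  have hs : IsSymmSndFDerivAt ℝ f x := hf.contDiffAt.isSymmSndFDerivAt (by simp; exact WithTop.coe_le_coe.2 le_top)
  have key : ∀ a b : Fin n, pd a (pd b f) x
      = fderiv ℝ (fderiv ℝ f) x (Pi.single a 1) (Pi.single b 1) := by
    intro a b
    unfold pd
    rw [fderiv_clm_apply hd (differentiableAt_const _)]
    simp
  rw [key, key, hs.eq]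

lemma box_eq {m : ℕ} (f : (Fin (m + 1) → ℝ) → ℝ) (x) :
    box f x = ∑ μ, sg μ * pd μ (pd μ f) x := rfl

lemma box_add {m : ℕ} {f g : (Fin (m + 1) → ℝ) → ℝ} (hf : Sm f) (hg : Sm g) (x) :
    box (fun y => f y + g y) x = box f x + box g x := by
  simp only [box_eq, pd_add hf hg, pd_add (hf.pd _) (hg.pd _), mul_add, Finset.sum_add_distrib]

lemma box_sub {m : ℕ} {f g : (Fin (m + 1) → ℝ) → ℝ} (hf : Sm f) (hg : Sm g) (x) :
    box (fun y => f y - g y) x = box f x - box g x := by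
  simp only [box_eq, pd_sub hf hg, pd_sub (hf.pd _) (hg.pd _), mul_sub, Finset.sum_sub_distrib]

lemma box_cmul {m : ℕ} {f : (Fin (m + 1) → ℝ) → ℝ} (hf : Sm f) (c : ℝ) (x) :
    box (fun y => c * f y) x = c * box f x := by
  simp only [box_eq, pd_cmul hf, pd_cmul (hf.pd _), Finset.mul_sum]
  exact Finset.sum_congr rfl fun _ _ => by ring

lemma box_sum {m : ℕ} {ι : Type} [Fintype ι] {f : ι → (Fin (m + 1) → ℝ) → ℝ}
    (hf : ∀ k, Sm (f k)) (x) :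
    box (fun y => ∑ k, f k y) x = ∑ k, box (f k) x := by
  simp only [box_eq, pd_sum hf, pd_sum (fun k => (hf k).pd _), Finset.mul_sum]
  exact Finset.sum_comm

lemma box_mul {m : ℕ} {f g : (Fin (m + 1) → ℝ) → ℝ} (hf : Sm f) (hg : Sm g) (x) :
    box (fun y => f y * g y) x
      = box f x * g x + 2 * (∑ ν, sg ν * (pd ν f x * pd ν g x)) + f x * box g x := by
  simp only [box_eq, pd_mul hf hg, Finset.mul_sum, Finset.sum_mul, ← Finset.sum_add_distrib]
  refine Finset.sum_congr rfl fun μ _ => ?_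
  rw [pd_add ((hf.pd μ).mul hg) (hf.mul (hg.pd μ)), pd_mul (hf.pd μ) hg, pd_mul hf (hg.pd μ)]
  ring

lemma box_pd {m : ℕ} {f : (Fin (m + 1) → ℝ) → ℝ} (hf : Sm f) (h : ∀ x, box f x = 0) (i) (x) :
    box (pd i f) x = 0 := by
  have e : box f = fun _ => 0 := funext h
  have h1 : pd i (box f) x = 0 := by rw [e]; simp [pd]
  have h2 : box f = fun y => ∑ μ, sg μ * pd μ (pd μ f) y := rfl
  rw [h2, pd_sum (fun k => contDiff_const.mul ((hf.pd k).pd k))] at h1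
  rw [box_eq, ← h1]
  refine Finset.sum_congr rfl fun μ _ => ?_
  rw [pd_cmul ((hf.pd μ).pd μ), pd_comm hf μ i, pd_comm (hf.pd μ) i μ]

/-- Lie point symmetries of the wave equation in `n`-dimensional Minkowski
spacetime (`n = m + 1 > 2`) in evolutionary form: if `ξ` is a CKV of the Minkowski metric
with conformal factor `ψ` satisfying `□ψ = 0`, and `□b = 0`, then for every smooth solution
`u` of `□u = 0` the characteristic `w = ((2−n)/2) ψ u + a₀ u + b − ξ^μ ∂_μ u` solves
`□w = 0`. -/
theorem stmt_8 {m : ℕ} (hm : 2 ≤ m)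
    (ξ : Fin (m + 1) → (Fin (m + 1) → ℝ) → ℝ) (ψ : (Fin (m + 1) → ℝ) → ℝ)
    (hξ : ∀ μ, ContDiff ℝ (⊤ : ℕ∞) (ξ μ)) (hψ : ContDiff ℝ (⊤ : ℕ∞) ψ)
    (hckv : ∀ μ ν x,
      pd μ (fun y => (if ν = 0 then (-1 : ℝ) else 1) * ξ ν y) x
        + pd ν (fun y => (if μ = 0 then (-1 : ℝ) else 1) * ξ μ y) x
      = 2 * ψ x * eta μ ν)
    (hψwave : ∀ x, box ψ x = 0)
    (a₀ : ℝ) (b : (Fin (m + 1) → ℝ) → ℝ) (hb : ContDiff ℝ (⊤ : ℕ∞) b)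
    (hbwave : ∀ x, box b x = 0) :
    ∀ u : (Fin (m + 1) → ℝ) → ℝ, ContDiff ℝ (⊤ : ℕ∞) u → (∀ x, box u x = 0) →
      ∀ x, box (fun y => ((2 - ((m : ℝ) + 1)) / 2) * ψ y * u y + a₀ * u y + b y
        - ∑ μ, ξ μ y * pd μ u y) x = 0 := by
  intro u hu huw x
  replace hξ : ∀ μ, Sm (ξ μ) := hξ
  replace hψ : Sm ψ := hψ
  replace hu : Sm u := hu
  have ck : ∀ μ ν x, sg ν * pd μ (ξ ν) x + sg μ * pd ν (ξ μ) x = 2 * ψ x * eta μ ν := by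
    intro μ ν x
    have := hckv μ ν x
    rw [pd_cmul (hξ ν), pd_cmul (hξ μ)] at this
    exact this
  have dg : ∀ μ x, pd μ (ξ μ) x = ψ x := by
    intro μ x
    have h := ck μ μ x
    have e : (eta μ μ : ℝ) = sg μ := by simp [eta, sg]
    rw [e] at h
    linear_combination (sg μ / 2) * h + (ψ x - pd μ (ξ μ) x) * sg_sq μ
  have od : ∀ μ ν x, μ ≠ ν → sg ν * pd μ (ξ ν) x + sg μ * pd ν (ξ μ) x = 0 := by
    intro μ ν x hne
    rw [ck]; simp [eta, hne]
  -- wave operator of the components of the vector field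
  have bx : ∀ μ x, box (ξ μ) x = (2 - ((m : ℝ) + 1)) * (sg μ * pd μ ψ x) := by
    intro μ x
    have t : ∀ ν, sg ν * pd ν (pd ν (ξ μ)) x
        = (if ν = μ then 2 * (sg μ * pd μ ψ x) else 0) - sg μ * pd μ ψ x := by
      intro ν
      have hψν : pd ν (ξ ν) = ψ := funext (dg ν)
      by_cases h : ν = μ
      · subst h
        rw [hψν, if_pos rfl]; ring
      · rw [if_neg h]
        have hf : pd ν (ξ μ) = fun y => (-(sg μ * sg ν)) * pd μ (ξ ν) y := by
          funext y
          have := od ν μ y h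
          linear_combination sg μ * this - pd ν (ξ μ) y * sg_sq μ
        rw [hf, pd_cmul ((hξ ν).pd μ), pd_comm (hξ ν) ν μ, hψν]
        linear_combination (-(sg μ * pd μ ψ x)) * sg_sq ν
    rw [box_eq, Finset.sum_congr rfl (fun ν _ => t ν), Finset.sum_sub_distrib]
    simp
    ring
  have cross : ∑ μ, ∑ ν, sg ν * (pd ν (ξ μ) x * pd ν (pd μ u) x) = 0 := by
    have h2 : ∑ μ, ∑ ν, sg ν * (pd ν (ξ μ) x * pd ν (pd μ u) x)
        + ∑ μ, ∑ ν, sg ν * (pd ν (ξ μ) x * pd ν (pd μ u) x) = 2 * ψ x * box u x := by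
      nth_rewrite 2 [Finset.sum_comm]
      rw [box_eq, Finset.mul_sum, ← Finset.sum_add_distrib]
      refine Finset.sum_congr rfl fun μ _ => ?_
      rw [← Finset.sum_add_distrib, Finset.sum_eq_single μ]
      · rw [dg]; ring
      · intro ν _ hne
        rw [pd_comm hu μ ν]
        have h := od ν μ x hne
        linear_combination sg μ * sg ν * pd ν (pd μ u) x * h
          - sg ν * pd ν (ξ μ) x * pd ν (pd μ u) x * sg_sq μ
          - sg μ * pd μ (ξ ν) x * pd ν (pd μ u) x * sg_sq ν
      · simp
    rw [huw] at h2
    linarith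
  have s1 : Sm (fun y => ((2 - ((m : ℝ) + 1)) / 2) * ψ y) := contDiff_const.mul hψ
  have s2 : Sm (fun y => ((2 - ((m : ℝ) + 1)) / 2) * ψ y * u y) := s1.mul hu
  have s3 : Sm (fun y => a₀ * u y) := contDiff_const.mul hu
  have s4 : ∀ μ, Sm (fun y => ξ μ y * pd μ u y) := fun μ => (hξ μ).mul (hu.pd μ)
  have s5 : Sm (fun y => ∑ μ, ξ μ y * pd μ u y) := ContDiff.sum fun μ _ => s4 μ
  rw [box_sub ((s2.add s3).add hb) s5, box_add (s2.add s3) hb, box_add s2 s3, box_cmul hu,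
    box_mul s1 hu, box_cmul hψ, box_sum s4, hbwave, hψwave, huw]
  have e : ∀ μ, box (fun y => ξ μ y * pd μ u y) x
      = (2 - ((m : ℝ) + 1)) * (sg μ * (pd μ ψ x * pd μ u x))
        + 2 * ∑ ν, sg ν * (pd ν (ξ μ) x * pd ν (pd μ u) x) := by
    intro μ
    rw [box_mul (hξ μ) (hu.pd μ), bx, box_pd hu huw]; ring
  rw [Finset.sum_congr rfl (fun μ _ => e μ), Finset.sum_add_distrib, ← Finset.mul_sum,
    ← Finset.mul_sum, cross]
  have e2 : ∑ ν, sg ν * (pd ν (fun y => ((2 - ((m : ℝ) + 1)) / 2) * ψ y) x * pd ν u x)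
      = ((2 - ((m : ℝ) + 1)) / 2) * ∑ ν, sg ν * (pd ν ψ x * pd ν u x) := by
    rw [Finset.mul_sum]
    refine Finset.sum_congr rfl fun ν _ => ?_
    rw [pd_cmul hψ]; ring
  rw [e2]
  ring
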